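/- Fix α ∈ (0,1) and positive integers v1, v2 with v2 ≤ v1, and define the discounted Q-values Q_α(s,a) = C(s,a) + α Σ_{s'} P_a(s,s') V_α(s'). If Q_α((v1, v2, 1), 1) ≤ Q_α((v1, v2, 1), 0), then for every integer x with 0 ≤ x ≤ v1 − v2 we also have Q_α((v1, v2+x, 1), 1) ≤ Q_α((v1, v2+x, 1), 0). (Discounted form of Lemma 4: if the α-optimal action at (v1,v2,1) is to transmit the fresh packet, the same is α-optimal at (v1,v2+x,1).) -/

import Mathlib

/-!
Re-transmission MDP: states `(v1, v2, b)` with `v1 : ℕ` (age at the user, `≥ 1`),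
`v2 : Option ℕ` (age of the packet at the BS; `none` means empty queue, i.e. `∞`),
`b : Bool` (fresh packet available).  Value iteration `Viter p q1 q2 α n v1 v2 b`
implements `V_{α,n}` as in the paper.
-/

noncomputable section

/-- Q-value of action `0` (re-transmit the old packet of age `k`) with continuation `W`. -/
def Qact0 (p q2 α : ℝ) (W : ℕ → Option ℕ → Bool → ℝ) (v1 k : ℕ) : ℝ :=
  q2 * ((k : ℝ) + 1) + (1 - q2) * ((v1 : ℝ) + 1)
    + α * (p * (1 - q2) * W (v1 + 1) (some (k + 1)) true
      + (1 - p) * (1 - q2) * W (v1 + 1) (some (k + 1)) false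
      + (1 - p) * q2 * W (k + 1) none false
      + p * q2 * W (k + 1) none true)

/-- Q-value of action `1` (transmit the fresh packet) with continuation `W`. -/
def Qact1 (p q1 α : ℝ) (W : ℕ → Option ℕ → Bool → ℝ) (v1 : ℕ) : ℝ :=
  q1 * 1 + (1 - q1) * ((v1 : ℝ) + 1)
    + α * (p * (1 - q1) * W (v1 + 1) (some 1) true
      + (1 - p) * (1 - q1) * W (v1 + 1) (some 1) false
      + (1 - p) * q1 * W 1 none false
      + p * q1 * W 1 none true)

/-- Q-value of action `2` (idle, empty queue) with continuation `W`. -/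
def Qact2 (p α : ℝ) (W : ℕ → Option ℕ → Bool → ℝ) (v1 : ℕ) : ℝ :=
  ((v1 : ℝ) + 1)
    + α * ((1 - p) * W (v1 + 1) none false + p * W (v1 + 1) none true)

/-- Value iteration `V_{α,n}` for the re-transmission MDP: `V_{α,0} = 0` and
`V_{α,n}(s) = min` over feasible actions of the corresponding Q-value. -/
def Viter (p q1 q2 α : ℝ) : ℕ → ℕ → Option ℕ → Bool → ℝ
  | 0 => fun _ _ _ => 0
  | n + 1 => fun v1 v2 b =>
      match v2, b with
      | none, false => Qact2 p α (Viter p q1 q2 α n) v1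
      | none, true => Qact1 p q1 α (Viter p q1 q2 α n) v1
      | some k, false => Qact0 p q2 α (Viter p q1 q2 α n) v1 k
      | some k, true =>
          min (Qact0 p q2 α (Viter p q1 q2 α n) v1 k)
            (Qact1 p q1 α (Viter p q1 q2 α n) v1)

end


/-- The discounted value function `V_α(s) = sup_n V_{α,n}(s)`. -/
noncomputable def Vdisc (p q1 q2 α : ℝ) (v1 : ℕ) (v2 : Option ℕ) (b : Bool) : ℝ :=
  ⨆ n : ℕ, Viter p q1 q2 α n v1 v2 b

/-- Re-transmission Q-values are monotone in the four continuation values and in the costs. -/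
lemma Qact0_mono_aux (p q2 α : ℝ) (hp0 : 0 ≤ p) (hp1 : p ≤ 1) (hq0 : 0 ≤ q2) (hq1 : q2 ≤ 1)
    (hα0 : 0 ≤ α) (W : ℕ → Option ℕ → Bool → ℝ) (v w k l : ℕ) (hvw : v ≤ w) (hkl : k ≤ l)
    (h1 : ∀ b, W (v + 1) (some (k + 1)) b ≤ W (w + 1) (some (l + 1)) b)
    (h2 : ∀ b, W (k + 1) none b ≤ W (l + 1) none b) :
    Qact0 p q2 α W v k ≤ Qact0 p q2 α W w l := by
  have a1 : 0 ≤ 1 - p := by linarith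
  have a2 : 0 ≤ 1 - q2 := by linarith
  have c1 : (v : ℝ) ≤ w := by exact_mod_cast hvw
  have c2 : (k : ℝ) ≤ l := by exact_mod_cast hkl
  have := h1 true
  have := h1 false
  have := h2 true
  have := h2 false
  unfold Qact0
  gcongr

lemma Viter_mono (p q1 q2 α : ℝ)
    (hp0 : 0 ≤ p) (hp1 : p ≤ 1) (hq10 : 0 ≤ q1) (hq11 : q1 ≤ 1) (hq20 : 0 ≤ q2) (hq21 : q2 ≤ 1)
    (hα0 : 0 ≤ α) (n : ℕ) :
    (∀ v w k l b, v ≤ w → k ≤ l →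
      Viter p q1 q2 α n v (some k) b ≤ Viter p q1 q2 α n w (some l) b) ∧
    (∀ v w b, v ≤ w → Viter p q1 q2 α n v none b ≤ Viter p q1 q2 α n w none b) := by
  have a1 : 0 ≤ 1 - p := by linarith
  have a2 : 0 ≤ 1 - q1 := by linarith
  induction n with
  | zero => simp [Viter]
  | succ n ih =>
    obtain ⟨ih1, ih2⟩ := ih
    have h0 : ∀ v w k l : ℕ, v ≤ w → k ≤ l → Qact0 p q2 α (Viter p q1 q2 α n) v k ≤
        Qact0 p q2 α (Viter p q1 q2 α n) w l := fun v w k l hvw hkl =>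
      Qact0_mono_aux p q2 α hp0 hp1 hq20 hq21 hα0 _ v w k l hvw hkl
        (fun b => ih1 _ _ _ _ b (by omega) (by omega)) (fun b => ih2 _ _ b (by omega))
    have h1 : ∀ v w : ℕ, v ≤ w → Qact1 p q1 α (Viter p q1 q2 α n) v ≤
        Qact1 p q1 α (Viter p q1 q2 α n) w := by
      intro v w hvw
      have c1 : (v : ℝ) ≤ w := by exact_mod_cast hvw
      have := ih1 (v+1) (w+1) 1 1 true (by omega) le_rfl
      have := ih1 (v+1) (w+1) 1 1 false (by omega) le_rfl
      unfold Qact1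
      gcongr
    have h2 : ∀ v w : ℕ, v ≤ w → Qact2 p α (Viter p q1 q2 α n) v ≤
        Qact2 p α (Viter p q1 q2 α n) w := by
      intro v w hvw
      have c1 : (v : ℝ) ≤ w := by exact_mod_cast hvw
      have := ih2 (v+1) (w+1) true (by omega)
      have := ih2 (v+1) (w+1) false (by omega)
      unfold Qact2
      gcongr
    constructor
    · intro v w k l b hvw hkl
      cases b
      · exact h0 v w k l hvw hkl
      · exact min_le_min (h0 v w k l hvw hkl) (h1 v w hvw)
    · intro v w b hvw
      cases b
      · exact h2 v w hvw
      · exact h1 v w hvw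

/-- Uniform-in-`n` linear bound on reachable states. -/
lemma Viter_bound (p q1 q2 α c : ℝ)
    (hp0 : 0 ≤ p) (hp1 : p ≤ 1) (hq10 : 0 ≤ q1) (hq11 : q1 ≤ 1) (hq20 : 0 ≤ q2) (hq21 : q2 ≤ 1)
    (hα0 : 0 ≤ α) (hc0 : 0 ≤ c) (hc : 1 + α * c = c) (n : ℕ) :
    (∀ v k b, k ≤ v → Viter p q1 q2 α n v (some k) b ≤ c * v + c * c) ∧
    (∀ v b, Viter p q1 q2 α n v none b ≤ c * v + c * c) := by
  have a1 : 0 ≤ 1 - p := by linarith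
  have a2 : 0 ≤ 1 - q1 := by linarith
  have a3 : 0 ≤ 1 - q2 := by linarith
  induction n with
  | zero =>
    constructor
    · intro v k b _; simp only [Viter]; positivity
    · intro v b; simp only [Viter]; positivity
  | succ n ih =>
    obtain ⟨ih1, ih2⟩ := ih
    have key : ∀ v : ℝ, (v + 1) + α * (c * (v + 1) + c * c) = c * v + c * c := by
      intro v
      linear_combination (v + 1 + c) * hc
    have h0 : ∀ v k : ℕ, k ≤ v → Qact0 p q2 α (Viter p q1 q2 α n) v k ≤ c * v + c * c := by
      intro v k hk
      have ck : (k : ℝ) ≤ v := by exact_mod_cast hk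
      have e1 := fun b => ih1 (v+1) (k+1) b (by omega)
      have e2 : ∀ b, Viter p q1 q2 α n (k+1) none b ≤ c * ((v:ℝ)+1) + c * c := by
        intro b
        refine (ih2 (k+1) b).trans ?_
        push_cast
        gcongr
      push_cast at e1
      have := e1 true
      have := e1 false
      have := e2 true
      have := e2 false
      rw [← key v]
      unfold Qact0
      calc _ ≤ q2 * ((v : ℝ) + 1) + (1 - q2) * ((v : ℝ) + 1)
            + α * (p * (1 - q2) * (c * ((v:ℝ)+1) + c * c)
            + (1 - p) * (1 - q2) * (c * ((v:ℝ)+1) + c * c)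
            + (1 - p) * q2 * (c * ((v:ℝ)+1) + c * c)
            + p * q2 * (c * ((v:ℝ)+1) + c * c)) := by gcongr
        _ = _ := by ring
    have h1 : ∀ v : ℕ, Qact1 p q1 α (Viter p q1 q2 α n) v ≤ c * v + c * c := by
      intro v
      have cv : (0 : ℝ) ≤ v := by positivity
      have e1 := fun b => ih1 (v+1) 1 b (by omega)
      have e2 : ∀ b, Viter p q1 q2 α n 1 none b ≤ c * ((v:ℝ)+1) + c * c := by
        intro b
        refine (ih2 1 b).trans ?_
        push_cast
        gcongr
        linarith
      push_cast at e1
      have := e1 true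
      have := e1 false
      have := e2 true
      have := e2 false
      have e3 : (1 : ℝ) ≤ (v : ℝ) + 1 := by linarith
      rw [← key v]
      unfold Qact1
      calc _ ≤ q1 * ((v : ℝ) + 1) + (1 - q1) * ((v : ℝ) + 1)
            + α * (p * (1 - q1) * (c * ((v:ℝ)+1) + c * c)
            + (1 - p) * (1 - q1) * (c * ((v:ℝ)+1) + c * c)
            + (1 - p) * q1 * (c * ((v:ℝ)+1) + c * c)
            + p * q1 * (c * ((v:ℝ)+1) + c * c)) := by gcongr
        _ = _ := by ring
    have h2 : ∀ v : ℕ, Qact2 p α (Viter p q1 q2 α n) v ≤ c * v + c * c := by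
      intro v
      have e1 := fun b => ih2 (v+1) b
      push_cast at e1
      have := e1 true
      have := e1 false
      rw [← key v]
      unfold Qact2
      calc _ ≤ ((v : ℝ) + 1)
            + α * ((1 - p) * (c * ((v:ℝ)+1) + c * c) + p * (c * ((v:ℝ)+1) + c * c)) := by gcongr
        _ = _ := by ring
    constructor
    · intro v k b hk
      cases b
      · exact h0 v k hk
      · exact (min_le_left _ _).trans (h0 v k hk)
    · intro v b
      cases b
      · exact h2 v
      · exact h1 v

/-- Discounted form of Lemma 4: the discounted Q-values
`Q_α(s,a) = C(s,a) + α Σ_{s'} P_a(s,s') V_α(s')` are `Qact0`/`Qact1` applied to `V_α`.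
If at `(v1, v2, 1)` transmitting the fresh packet is α-optimal
(`Q_α(s,1) ≤ Q_α(s,0)`), the same holds at `(v1, v2 + x, 1)` for `0 ≤ x ≤ v1 − v2`. -/
theorem qval_switch_structure_discounted (p q1 q2 α : ℝ)
    (hp0 : 0 < p) (hp1 : p ≤ 1) (hq10 : 0 < q1) (hq12 : q1 < q2) (hq21 : q2 < 1)
    (hα0 : 0 < α) (hα1 : α < 1)
    (v1 v2 : ℕ) (hv1 : 1 ≤ v1) (hv2 : 1 ≤ v2) (h21 : v2 ≤ v1)
    (h : Qact1 p q1 α (Vdisc p q1 q2 α) v1 ≤ Qact0 p q2 α (Vdisc p q1 q2 α) v1 v2)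
    (x : ℕ) (hx : v2 + x ≤ v1) :
    Qact1 p q1 α (Vdisc p q1 q2 α) v1 ≤ Qact0 p q2 α (Vdisc p q1 q2 α) v1 (v2 + x) := by
  have hq11 : q1 ≤ 1 := by linarith
  have hq20 : 0 ≤ q2 := by linarith
  have hc0 : 0 ≤ (1 - α)⁻¹ := inv_nonneg.mpr (by linarith)
  have hc : 1 + α * (1 - α)⁻¹ = (1 - α)⁻¹ := by
    have : 1 - α ≠ 0 := by linarith
    field_simp
    ring
  have hm := Viter_mono p q1 q2 α hp0.le hp1 hq10.le hq11 hq20 hq21.le hα0.le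
  have hb := Viter_bound p q1 q2 α _ hp0.le hp1 hq10.le hq11 hq20 hq21.le hα0.le hc0 hc
  refine h.trans (Qact0_mono_aux p q2 α hp0.le hp1 hq20 hq21.le hα0.le _ _ _ _ _ le_rfl
    (by omega) ?_ ?_)
  · intro b
    refine ciSup_mono ⟨(1 - α)⁻¹ * ((v1 + 1 : ℕ) : ℝ) + (1 - α)⁻¹ * (1 - α)⁻¹, ?_⟩
      fun n => (hm n).1 _ _ _ _ b le_rfl (by omega)
    rintro _ ⟨n, rfl⟩
    exact (hb n).1 _ _ b (by omega)
  · intro b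
    refine ciSup_mono ⟨(1 - α)⁻¹ * ((v2 + x + 1 : ℕ) : ℝ) + (1 - α)⁻¹ * (1 - α)⁻¹, ?_⟩
      fun n => (hm n).2 _ _ b (by omega)
    rintro _ ⟨n, rfl⟩
    exact (hb n).2 _ b
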